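/- Let [a,b] be a segment and m a multisegment in good range for [a,b]. For all sufficiently large r ∈ ℤ_{>0}: (i) if |I^Lang_{[a,b]}(m)| = |m|, then D^{Lang,L}_{[a,b]}(𝔻_r(m)) ≠ ∞ and D^{Lang,L}_{[a,b]}(𝔻_r(m)) = 𝔻_r(I^Lang_{[a,b]}(m)); (ii) if |I^Lang_{[a,b]}(m)| > |m|, then D^{Lang,L}_{[a,b]}(𝔻_r^{[a,b]}(m)) ≠ ∞ and D^{Lang,L}_{[a,b]}(𝔻_r^{[a,b]}(m)) = 𝔻_r(I^Lang_{[a,b]}(m)); (iii) |I^Lang_{[a,b]}(m)| = |m| if and only if D^{Lang,L}_{[a,b]}(𝔻_r(m)) ≠ ∞. -/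

import Mathlib

namespace Multiseg

/-- A segment `[a,b]` on a fixed cuspidal line, encoded by its endpoints. -/
abbrev Seg := ℤ × ℤ

/-- A multiset of pairs is a multisegment when each pair is a genuine segment. -/
def IsMS (m : Multiset Seg) : Prop := ∀ Δ ∈ m, Δ.1 ≤ Δ.2

/-- `Δ ≺ Δ'` : the segment `Δ` precedes `Δ'`. -/
def Prec (Δ Δ' : Seg) : Prop := Δ.1 < Δ'.1 ∧ Δ.2 < Δ'.2 ∧ Δ'.1 ≤ Δ.2 + 1

instance : DecidableRel Prec := fun _ _ => by unfold Prec; infer_instance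

/-- `Δ ⊆ Δ'` as segments. -/
def SSub (Δ Δ' : Seg) : Prop := Δ'.1 ≤ Δ.1 ∧ Δ.2 ≤ Δ'.2

/-- `m[i]`, the segments of `m` starting at `i`. -/
def startAt (m : Multiset Seg) (i : ℤ) : Multiset Seg := m.filter fun Δ => Δ.1 = i

/-- `m⟨i⟩`, the segments of `m` ending at `i`. -/
def endAt (m : Multiset Seg) (i : ℤ) : Multiset Seg := m.filter fun Δ => Δ.2 = i

/-- `m_{[a,b]} = {[a',b'] ∈ m : a ≤ a' ≤ b+1 ≤ b'+1}`. -/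
def mRange (m : Multiset Seg) (a b : ℤ) : Multiset Seg :=
  m.filter fun Δ => a ≤ Δ.1 ∧ Δ.1 ≤ b + 1 ∧ b ≤ Δ.2

/-- Add the segment `[x,y]` to `m`, discarding it if it is void. -/
def pushSeg (m : Multiset Seg) (x y : ℤ) : Multiset Seg :=
  if x ≤ y then m + {(x, y)} else m

def msetMax (s : Multiset ℤ) : Option ℤ :=
  if h : s = 0 then none else some (s.toFinset.max' (Multiset.toFinset_nonempty.mpr h))

def msetMin (s : Multiset ℤ) : Option ℤ :=
  if h : s = 0 then none else some (s.toFinset.min' (Multiset.toFinset_nonempty.mpr h))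

/-- The longest segment of `m[i]`, if any. -/
def longStart (m : Multiset Seg) (i : ℤ) : Option Seg :=
  (msetMax ((startAt m i).map Prod.snd)).map fun y => (i, y)

/-- The shortest segment of `m[i]`, if any. -/
def shortStart (m : Multiset Seg) (i : ℤ) : Option Seg :=
  (msetMin ((startAt m i).map Prod.snd)).map fun y => (i, y)

/-- The longest segment of `m⟨i⟩`, if any. -/
def longEnd (m : Multiset Seg) (i : ℤ) : Option Seg :=
  (msetMin ((endAt m i).map Prod.fst)).map fun x => (x, i)

/-- The shortest segment of `m⟨i⟩`, if any. -/
def shortEnd (m : Multiset Seg) (i : ℤ) : Option Seg :=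
  (msetMax ((endAt m i).map Prod.fst)).map fun x => (x, i)

/-- One removal step of the `tds(·,c)` process: remove the longest segment `Δ''`
of `m[c+1]` and the longest segment `Δ'` of `m[c]` with `Δ' ≺ Δ''`. -/
def tdsStep (m : Multiset Seg) (c : ℤ) : Option (Multiset Seg) :=
  match longStart m (c + 1) with
  | none => none
  | some Δ'' =>
    match msetMax (((startAt m c).filter fun Δ => Prec Δ Δ'').map Prod.snd) with
    | none => none
    | some y => some ((m.erase (c, y)).erase Δ'')

def tdsIterF (c : ℤ) : ℕ → Multiset Seg → Multiset Seg
  | 0, m => m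
  | n + 1, m =>
    match tdsStep m c with
    | none => m
    | some m' => tdsIterF c n m'

/-- Iterate the `tds(·,c)` process until it terminates. -/
def tdsIter (c : ℤ) (m : Multiset Seg) : Multiset Seg := tdsIterF c m.card m

/-- The `ρ`-derivative algorithm `𝒟_{[a]}`; the value `none` codes `∞`. -/
def Drho (a : ℤ) (m : Multiset Seg) : Option (Multiset Seg) :=
  (shortStart (tdsIter a m) a).map fun Δ => pushSeg (m.erase Δ) (a + 1) Δ.2

/-- `ε_{[a]}(m)`, the number of segments starting at `a` left after the
`tds(·,a)` process terminates. -/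
def epsA (a : ℤ) (m : Multiset Seg) : ℕ := (startAt (tdsIter a m) a).card

/-- The next element of an upward sequence after `p`. -/
def usNext (n : Multiset Seg) (p : Seg) : Option Seg :=
  match msetMin ((n.filter fun Δ => Prec p Δ).map Prod.fst) with
  | none => none
  | some aj =>
    (msetMax ((((n.filter fun Δ => Prec p Δ).filter fun Δ => Δ.1 = aj)).map Prod.snd)).map
      fun y => (aj, y)

def usAux (n : Multiset Seg) : ℕ → Seg → List Seg
  | 0, _ => []
  | fuel + 1, p =>
    match usNext n p with
    | none => []
    | some Δ => Δ :: usAux n fuel Δ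

/-- The upward sequence `Us(n)` of maximally linked segments of `n`. -/
def usList (n : Multiset Seg) : List Seg :=
  match msetMin (n.map Prod.fst) with
  | none => []
  | some a1 =>
    match longStart n a1 with
    | none => []
    | some Δ1 => Δ1 :: usAux n n.card Δ1

/-- The decomposition of a multisegment into successive upward sequences. -/
def usDecomp : ℕ → Multiset Seg → List (List Seg)
  | 0, _ => []
  | fuel + 1, n =>
    if n = 0 then [] else usList n :: usDecomp fuel (n - (usList n : Multiset Seg))

/-- `[x,y] ⊆ [u,v]` (with the void interval contained in anything). -/
def intSubB (x y u v : ℤ) : Bool := decide (y < x) || (decide (u ≤ x) && decide (y ≤ v))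

/-- Find, in a row of an upward-sequence decomposition, the first segment `Δ`
whose removable free section contains `[s(Δ), top]`. -/
def findRowD : List Seg → ℤ → Option Seg
  | [], _ => none
  | [Δ], top => if intSubB Δ.1 top Δ.1 Δ.2 then some Δ else none
  | Δ :: Δ' :: rest, top =>
    if intSubB Δ.1 top Δ.1 (Δ'.1 - 2) then some Δ else findRowD (Δ' :: rest) top

/-- The selection step of the Langlands derivative algorithm, scanning the rows
downwards from the last one; it records each selected segment together with the
start of its truncation. -/
def selAuxD (rows : List (List Seg)) : ℕ → ℤ → List (Seg × ℤ)
  | 0, _ => []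
  | n + 1, top =>
    match findRowD (rows.getD n []) top with
    | some Δ => (Δ, top + 1) :: selAuxD rows n (Δ.1 - 1)
    | none => selAuxD rows n top

/-- The Langlands derivative algorithm `𝒟^Lang_{[a,b]}`; `none` codes `∞`. -/
def DLang (a b : ℤ) (m : Multiset Seg) : Option (Multiset Seg) :=
  let m1 := mRange m a b
  let rows := usDecomp m1.card m1
  let sel := selAuxD rows rows.length b
  match sel.getLast? with
  | none => none
  | some (Δl, _) =>
    if Δl.1 = a then
      some (sel.foldl (fun acc p => pushSeg (acc.erase p.1) p.2 p.1.2) m)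
    else none

/-- One removal step of the `tus(·,c)` process. -/
def tusStep (n : Multiset Seg) (c : ℤ) : Option (Multiset Seg) :=
  match shortStart n c with
  | none => none
  | some Δ' =>
    match msetMin (((startAt n (c + 1)).filter fun Δ => Prec Δ' Δ).map Prod.snd) with
    | none => none
    | some y => some ((n.erase Δ').erase (c + 1, y))

def tusIterF (c : ℤ) : ℕ → Multiset Seg → Multiset Seg
  | 0, n => n
  | k + 1, n =>
    match tusStep n c with
    | none => n
    | some n' => tusIterF c k n'

/-- Iterate the `tus(·,c)` process until it terminates. -/
def tusIter (c : ℤ) (n : Multiset Seg) : Multiset Seg := tusIterF c n.card n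

/-- The `ρ`-integral algorithm `ℐ_{[a]}` (always defined). -/
def Irho (a : ℤ) (n : Multiset Seg) : Multiset Seg :=
  match longStart (tusIter a n) (a + 1) with
  | none => n + {(a, a)}
  | some Δ => pushSeg (n.erase Δ) a Δ.2

/-- The next element of a downward sequence after `p`. -/
def dsNext (n : Multiset Seg) (p : Seg) : Option Seg :=
  match msetMax ((n.filter fun Δ => Prec Δ p).map Prod.fst) with
  | none => none
  | some aq => shortStart n aq

def dsAux (n : Multiset Seg) : ℕ → Seg → List Seg
  | 0, _ => []
  | k + 1, p =>
    match dsNext n p with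
    | none => []
    | some Δ => Δ :: dsAux n k Δ

/-- The downward sequence `Ds(n)` of minimal linked segments with the largest
starting. -/
def dsList (n : Multiset Seg) : List Seg :=
  match msetMax (n.map Prod.fst) with
  | none => []
  | some a1 =>
    match shortStart n a1 with
    | none => []
    | some Δ1 => Δ1 :: dsAux n n.card Δ1

/-- The decomposition of a multisegment into successive downward sequences. -/
def dsDecomp : ℕ → Multiset Seg → List (List Seg)
  | 0, _ => []
  | k + 1, n =>
    if n = 0 then [] else dsList n :: dsDecomp k (n - (dsList n : Multiset Seg))

/-- Find, in a row of a downward-sequence decomposition, the segment whose set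
of addable free points contains `pt`. -/
def findRowI (a : ℤ) : List Seg → ℤ → Option Seg
  | [], _ => none
  | [Δ], pt => if decide (a ≤ pt) && decide (pt ≤ Δ.1 - 1) then some Δ else none
  | Δ :: Δ' :: rest, pt =>
    if decide (Δ'.1 + 1 ≤ pt) && decide (pt ≤ Δ.1 - 1) then some Δ
    else findRowI a (Δ' :: rest) pt

/-- The selection step of the Langlands integral algorithm; it records each
selected segment together with the start of its extension. -/
def selAuxI (a : ℤ) (rows : List (List Seg)) : ℕ → ℤ → List (Seg × ℤ)
  | 0, _ => []
  | n + 1, pt =>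
    match findRowI a (rows.getD n []) pt with
    | some Δ => (Δ, pt) :: selAuxI a rows n Δ.1
    | none => selAuxI a rows n pt

/-- The Langlands integral algorithm `ℐ^Lang_{[a,b]}`. -/
def ILang (a b : ℤ) (m : Multiset Seg) : Multiset Seg :=
  let m1 := mRange m a b
  let rows := dsDecomp m1.card m1
  let sel := selAuxI a rows rows.length a
  let base := sel.foldl (fun acc p => pushSeg (acc.erase p.1) p.2 p.1.2) m
  match sel.getLast? with
  | none => pushSeg base a b
  | some (Δl, _) => pushSeg base Δl.1 b

/-- `m` is in good range for `[a,b]`. -/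
def GoodRange (m : Multiset Seg) (a b : ℤ) : Prop := mRange m a b = m

/-- `Θ`, the Gelfand–Kazhdan involution on multisegments. -/
def Theta (m : Multiset Seg) : Multiset Seg := m.map fun Δ => (-Δ.2, -Δ.1)

/-- The exotic duality `𝔻_r`. -/
def Dual (r : ℤ) (m : Multiset Seg) : Multiset Seg :=
  m.map fun Δ => (-r + Δ.2 + 1, Δ.1 - 1)

/-- `𝔻_r^{[a,b]}`. -/
def DualAB (r a b : ℤ) (m : Multiset Seg) : Multiset Seg := Dual r m + {(b - r + 1, b)}

/-- The left Langlands derivative algorithm `𝒟^{Lang,L}_{[a,b]}`. -/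
def DLangL (a b : ℤ) (m : Multiset Seg) : Option (Multiset Seg) :=
  (DLang (-b) (-a) (Theta m)).map Theta

/-- The left `ρ`-derivative algorithm `𝒟^{Lang,L}_{[a]}`. -/
def DrhoL (a : ℤ) (m : Multiset Seg) : Option (Multiset Seg) :=
  (Drho (-a) (Theta m)).map Theta

/-- The next segment chosen by the MW algorithm after `p`. -/
def mwNext (m : Multiset Seg) (p : Seg) : Option Seg :=
  (msetMax (((endAt m (p.2 - 1)).filter fun Δ => Prec Δ p).map Prod.fst)).map
    fun x => (x, p.2 - 1)

def mwAux (m : Multiset Seg) : ℕ → Seg → List Seg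
  | 0, _ => []
  | k + 1, p =>
    match mwNext m p with
    | none => []
    | some Δ => Δ :: mwAux m k Δ

/-- The ordered segments participating in the MW algorithm for `m`. -/
def mwList (m : Multiset Seg) : List Seg :=
  match msetMax (m.map Prod.snd) with
  | none => []
  | some b0 =>
    match shortEnd m b0 with
    | none => []
    | some Δ0 => Δ0 :: mwAux m m.card Δ0

/-- `𝒟^MW(m)`. -/
def DMW (m : Multiset Seg) : Multiset Seg :=
  (mwList m).foldl (fun acc Δ => pushSeg (acc.erase Δ) Δ.1 (Δ.2 - 1)) m

/-- The first segment `Δ(m)` produced by the MW algorithm for `m`. -/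
def mwFirstSeg (m : Multiset Seg) : Option Seg :=
  match (mwList m).head?, (mwList m).getLast? with
  | some Δ0, some Δk => some (Δk.1, Δ0.2)
  | _, _ => none

/-- The total relative length of a multisegment. -/
def totalLen (m : Multiset Seg) : ℕ := (m.map fun Δ => (Δ.2 - Δ.1 + 1).toNat).sum

def sharpAux : ℕ → Multiset Seg → Multiset Seg
  | 0, _ => 0
  | k + 1, m =>
    if m = 0 then 0
    else
      match mwFirstSeg m with
      | none => 0
      | some Δ => Δ ::ₘ sharpAux k (DMW m)

/-- The Mœglin–Waldspurger involution `m^#`. -/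
def msharp (m : Multiset Seg) : Multiset Seg := sharpAux (totalLen m) m

/-- `ε^MW_{[a,c]}(m)`, the multiplicity of `[a,c]` in `m^#`. -/
def epsMW (a c : ℤ) (m : Multiset Seg) : ℕ := (msharp m).count (a, c)

/-- `m_i`: remove from `m` the participants of the first `i` runs of the MW
algorithm. -/
def mwStage (m : Multiset Seg) : ℕ → Multiset Seg
  | 0 => m
  | i + 1 => mwStage m i - (mwList (DMW^[i] m) : Multiset Seg)

/-- `MW_k(m)`: all segments ending at `k` participating in the first `r` runs
of the MW algorithm. -/
def MWkSet (m : Multiset Seg) (r : ℕ) (k : ℤ) : Multiset Seg :=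
  ∑ i ∈ Finset.range r, (mwList (DMW^[i] m) : Multiset Seg).filter fun Δ => Δ.2 = k

def upNbrAux (m : Multiset Seg) : ℕ → Seg → Option (List Seg)
  | 0, p => some [p]
  | k + 1, p =>
    match msetMin (((endAt m (p.2 + 1)).filter fun Δ => Prec p Δ).map Prod.fst) with
    | none => none
    | some x => (upNbrAux m k (x, p.2 + 1)).map fun l => p :: l

/-- The removal upward sequence of maximal linked segments in neighbors on `m`
ranging from `a-1` to `b` (if it exists). -/
def upSeqNbr (m : Multiset Seg) (a b : ℤ) : Option (List Seg) :=
  match longEnd m (a - 1) with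
  | none => none
  | some Δ => upNbrAux m (b - (a - 1)).toNat Δ

def zelRemF (a b : ℤ) : ℕ → Multiset Seg → Multiset Seg
  | 0, m => m
  | k + 1, m =>
    match upSeqNbr m a b with
    | none => m
    | some l => zelRemF a b k (m - (l : Multiset Seg))

/-- Repeatedly remove removal upward sequences of maximal linked segments in
neighbors ranging from `a-1` to `b`, until none exists. -/
def zelRem (a b : ℤ) (m : Multiset Seg) : Multiset Seg := zelRemF a b m.card m

def zelRemCountF (a b : ℤ) : ℕ → Multiset Seg → ℕ
  | 0, _ => 0
  | k + 1, m =>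
    match upSeqNbr m a b with
    | none => 0
    | some l => zelRemCountF a b k (m - (l : Multiset Seg)) + 1

/-- The number of removal upward sequences of maximal linked segments in
neighbors ranging from `a-1` to `b` successively removed from `m`. -/
def zelRemCount (a b : ℤ) (m : Multiset Seg) : ℕ := zelRemCountF a b m.card m

def downNbrAux (m : Multiset Seg) : ℕ → Seg → Option (List Seg)
  | 0, p => some [p]
  | k + 1, p =>
    match msetMax (((endAt m (p.2 - 1)).filter fun Δ => Prec Δ p).map Prod.fst) with
    | none => none
    | some x => (downNbrAux m k (x, p.2 - 1)).map fun l => p :: l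

/-- The Zelevinsky derivative algorithm `𝒟^Zel_{[a,b]}`; `none` codes `∞`. -/
def DZel (a b : ℤ) (m : Multiset Seg) : Option (Multiset Seg) :=
  match shortEnd (zelRem a b m) b with
  | none => none
  | some Δb =>
    match downNbrAux (zelRem a b m) (b - a).toNat Δb with
    | none => none
    | some l => some (l.foldl (fun acc Δ => pushSeg (acc.erase Δ) Δ.1 (Δ.2 - 1)) m)

/-- The downward sequence of minimal linked segments in neighbors on `m`
ranging from `b` to `a-1` (if it exists). -/
def downSeqNbr (m : Multiset Seg) (a b : ℤ) : Option (List Seg) :=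
  match shortEnd m b with
  | none => none
  | some Δ => downNbrAux m (b - (a - 1)).toNat Δ

def izRemF (a b : ℤ) : ℕ → Multiset Seg → Multiset Seg
  | 0, m => m
  | k + 1, m =>
    match downSeqNbr m a b with
    | none => m
    | some l => izRemF a b k (m - (l : Multiset Seg))

/-- Repeatedly remove downward sequences of minimal linked segments in
neighbors ranging from `b` to `a-1`, until none exists. -/
def izRem (a b : ℤ) (m : Multiset Seg) : Multiset Seg := izRemF a b m.card m

def extNext (m : Multiset Seg) (p : Seg) : Option Seg :=
  (msetMin (((endAt m (p.2 + 1)).filter fun Δ => Prec p Δ).map Prod.fst)).map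
    fun x => (x, p.2 + 1)

def extAux (m : Multiset Seg) : ℕ → Option Seg → List (Option Seg)
  | 0, _ => []
  | k + 1, p =>
    let cur := p.bind (extNext m)
    cur :: extAux m k cur

/-- The (possibly void) segments `Δ̃_{a-1}, …, Δ̃_{b-1}` participating in the
extension process of the Zelevinsky integral algorithm on `m`. -/
def extList (m : Multiset Seg) (a b : ℤ) : List (Option Seg) :=
  longEnd m (a - 1) :: extAux m (b - a).toNat (longEnd m (a - 1))

def applyExt : Multiset Seg → ℤ → List (Option Seg) → Multiset Seg
  | acc, _, [] => acc
  | acc, i, some Δ :: rest => applyExt (pushSeg (acc.erase Δ) Δ.1 (Δ.2 + 1)) (i + 1) rest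
  | acc, i, none :: rest => applyExt (acc + {(i + 1, i + 1)}) (i + 1) rest

/-- The Zelevinsky integral algorithm `ℐ^Zel_{[a,b]}`. -/
def IZel (a b : ℤ) (m : Multiset Seg) : Multiset Seg :=
  applyExt m (a - 1) (extList (izRem a b m) a b)

/-- `Δ̃⁺` for a possibly void `Δ̃` at position `i` (for the void segment at
position `i` this is the singleton `[i+1,i+1]`). -/
def plusAt (i : ℤ) : Option Seg → Seg
  | some Δ => (Δ.1, Δ.2 + 1)
  | none => (i + 1, i + 1)

def plusList : ℤ → List (Option Seg) → List Seg
  | _, [] => []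
  | i, o :: rest => plusAt i o :: plusList (i + 1) rest

/-- `n₁` and `n₂` are linked by mapping: there is an injective map `f : n₁ → n₂`
with `Δ ≺ f(Δ)` for all `Δ ∈ n₁`. -/
def LinkedByMapping (n₁ n₂ : Multiset Seg) : Prop :=
  ∃ n₂' ≤ n₂, Multiset.Rel Prec n₁ n₂'

def startsSorted (n : Multiset Seg) : List ℤ := (n.map Prod.fst).sort (· ≤ ·)

/-- `n₁' < n₁` for multisegments of segments ending at a common point, compared
via their sorted lists of starting points. -/
def MSLtStarts (n₁' n₁ : Multiset Seg) : Prop :=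
  startsSorted n₁' ≠ startsSorted n₁ ∧
    List.Forall₂ (· ≤ ·) (startsSorted n₁) (startsSorted n₁')

/-- `n₁ ⊆ m⟨k-1⟩` and `n₂ ⊆ m⟨k⟩` are minimally linked in `m`. -/
def MinLinked (m : Multiset Seg) (k : ℤ) (n₁ n₂ : Multiset Seg) : Prop :=
  n₁ ≤ endAt m (k - 1) ∧ n₂ ≤ endAt m k ∧ LinkedByMapping n₁ n₂ ∧
    (∀ n₁' ≤ endAt m (k - 1), LinkedByMapping n₁' n₂ → n₁'.card ≤ n₁.card) ∧
    (∀ n₁' ≤ endAt m (k - 1), n₁'.card = n₁.card → MSLtStarts n₁' n₁ →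
      ¬LinkedByMapping n₁' n₂)

/-- The non-free sections of a row of an upward-sequence decomposition. -/
def nfRow : List Seg → Multiset Seg
  | [] => 0
  | [_] => 0
  | Δ :: Δ' :: rest => pushSeg (nfRow (Δ' :: rest)) (Δ'.1 - 1) Δ.2

/-- `𝔡(m)`, the sum of all non-free sections. -/
def frakd (m : Multiset Seg) : Multiset Seg :=
  (usDecomp m.card m).foldl (fun acc row => acc + nfRow row) 0

def DrhoPow (t : ℤ) : ℕ → Multiset Seg → Option (Multiset Seg)
  | 0, m => some m
  | k + 1, m => (Drho t m).bind (DrhoPow t k)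

/-- `(𝒟_{[a+n-1]})^{ε_{a+n-1}} ∘ ⋯ ∘ (𝒟_{[a]})^{ε_a}(m)` where at each stage `t`
the exponent is `ε_t = ε_{[t]}` of the current multisegment; `none` codes that
some derivative in the composition is `∞`. -/
def hdComp : ℕ → ℤ → Multiset Seg → Option (Multiset Seg)
  | 0, _, m => some m
  | k + 1, t, m =>
    match DrhoPow t (epsA t m) m with
    | none => none
    | some m' => hdComp k (t + 1) m'


/-! ### Auxiliary material for the proof -/

/-- The composite of `Θ` and `𝔻_r` on segments. -/
def phi (r : ℤ) (Δ : Seg) : Seg := (1 - Δ.1, r - 1 - Δ.2)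

theorem phi_inj (r : ℤ) : Function.Injective (phi r) := by
  rintro ⟨x, y⟩ ⟨u, v⟩ h
  simp only [phi, Prod.mk.injEq] at h ⊢
  omega

theorem theta_dual (r : ℤ) (m : Multiset Seg) : Theta (Dual r m) = m.map (phi r) := by
  simp only [Theta, Dual, Multiset.map_map]
  refine Multiset.map_congr rfl fun Δ _ => ?_
  simp only [phi, Function.comp, Prod.mk.injEq]
  omega

theorem theta_phi (r : ℤ) (m : Multiset Seg) : Theta (m.map (phi r)) = Dual r m := by
  simp only [Theta, Dual, Multiset.map_map]
  refine Multiset.map_congr rfl fun Δ _ => ?_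
  simp only [phi, Function.comp, Prod.mk.injEq]
  omega

theorem msetMax_none {s : Multiset ℤ} : msetMax s = none ↔ s = 0 := by
  unfold msetMax; split <;> simp_all

theorem msetMin_none {s : Multiset ℤ} : msetMin s = none ↔ s = 0 := by
  unfold msetMin; split <;> simp_all

theorem msetMax_some {s : Multiset ℤ} {x : ℤ} :
    msetMax s = some x ↔ x ∈ s ∧ ∀ y ∈ s, y ≤ x := by
  unfold msetMax
  split
  · simp_all
  · rename_i h
    rw [Option.some.injEq, Finset.max'_eq_iff]
    simp

theorem msetMin_some {s : Multiset ℤ} {x : ℤ} :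
    msetMin s = some x ↔ x ∈ s ∧ ∀ y ∈ s, x ≤ y := by
  unfold msetMin
  split
  · simp_all
  · rename_i h
    rw [Option.some.injEq, Finset.min'_eq_iff]
    simp

theorem msetMin_sub (c : ℤ) (s : Multiset ℤ) :
    msetMin (s.map fun x => c - x) = (msetMax s).map fun x => c - x := by
  cases h : msetMax s with
  | none => rw [msetMax_none] at h; subst h; simp [msetMin]
  | some x =>
    rw [msetMax_some] at h
    rw [Option.map_some, msetMin_some]
    refine ⟨Multiset.mem_map_of_mem _ h.1, ?_⟩
    intro y hy
    obtain ⟨z, hz, rfl⟩ := Multiset.mem_map.1 hy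
    have := h.2 z hz
    omega

theorem msetMax_sub (c : ℤ) (s : Multiset ℤ) :
    msetMax (s.map fun x => c - x) = (msetMin s).map fun x => c - x := by
  cases h : msetMin s with
  | none => rw [msetMin_none] at h; subst h; simp [msetMax]
  | some x =>
    rw [msetMin_some] at h
    rw [Option.map_some, msetMax_some]
    refine ⟨Multiset.mem_map_of_mem _ h.1, ?_⟩
    intro y hy
    obtain ⟨z, hz, rfl⟩ := Multiset.mem_map.1 hy
    have := h.2 z hz
    omega

theorem map_phi_fst (r : ℤ) (n : Multiset Seg) :
    (n.map (phi r)).map Prod.fst = (n.map Prod.fst).map fun x => 1 - x := by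
  simp [Multiset.map_map, phi, Function.comp_def]

theorem map_phi_snd (r : ℤ) (n : Multiset Seg) :
    (n.map (phi r)).map Prod.snd = (n.map Prod.snd).map fun x => (r - 1) - x := by
  simp [Multiset.map_map, phi, Function.comp_def]

theorem startAt_phi (r : ℤ) (n : Multiset Seg) (i : ℤ) :
    startAt (n.map (phi r)) (1 - i) = (startAt n i).map (phi r) := by
  unfold startAt
  rw [Multiset.filter_map]
  congr 1
  refine Multiset.filter_congr fun Δ _ => ?_
  simp only [phi, Function.comp]
  omega

theorem longStart_phi (r : ℤ) (n : Multiset Seg) (i : ℤ) :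
    longStart (n.map (phi r)) (1 - i) = (shortStart n i).map (phi r) := by
  unfold longStart shortStart
  rw [startAt_phi, map_phi_snd, msetMax_sub]
  simp [Option.map_map, Function.comp_def, phi]

theorem shortStart_some {n : Multiset Seg} {i : ℤ} {Δ : Seg} (h : shortStart n i = some Δ) :
    Δ ∈ n ∧ Δ.1 = i ∧ ∀ E ∈ n, E.1 = i → Δ.2 ≤ E.2 := by
  unfold shortStart at h
  obtain ⟨y, hy, rfl⟩ := Option.map_eq_some_iff.1 h
  rw [msetMin_some] at hy
  obtain ⟨h1, h2⟩ := hy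
  obtain ⟨E, hE, rfl⟩ := Multiset.mem_map.1 h1
  obtain ⟨hEn, rfl⟩ := Multiset.mem_filter.1 hE
  refine ⟨hEn, rfl, ?_⟩
  intro E' hE' he
  exact h2 _ (Multiset.mem_map_of_mem _ (Multiset.mem_filter.2 ⟨hE', he⟩))

theorem shortStart_isSome {n : Multiset Seg} {Δ : Seg} (h : Δ ∈ n) :
    ∃ E, shortStart n Δ.1 = some E := by
  cases hs : shortStart n Δ.1 with
  | some E => exact ⟨E, rfl⟩
  | none =>
    unfold shortStart at hs
    rw [Option.map_eq_none_iff, msetMin_none] at hs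
    have : Δ.2 ∈ (startAt n Δ.1).map Prod.snd :=
      Multiset.mem_map_of_mem _ (Multiset.mem_filter.2 ⟨h, rfl⟩)
    rw [hs] at this
    simp at this

/-- The range condition, without the requirement that the pair be a segment, plus a bound. -/
def Rg (a b r : ℤ) (n : Multiset Seg) : Prop :=
  ∀ Δ ∈ n, a ≤ Δ.1 ∧ Δ.1 ≤ b + 1 ∧ b ≤ Δ.2 ∧ Δ.2 ≤ r - 2 + a

theorem prec_phi {a b r : ℤ} {n : Multiset Seg} (hn : Rg a b r n) {p Δ : Seg} (hp : p ∈ n)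
    (hΔ : Δ ∈ n) : Prec (phi r p) (phi r Δ) ↔ Prec Δ p := by
  have h1 := hn p hp
  have h2 := hn Δ hΔ
  simp only [Prec, phi]
  omega

theorem dsNext_some {n : Multiset Seg} {p Δ : Seg} (h : dsNext n p = some Δ) :
    Δ ∈ n ∧ Δ.1 < p.1 := by
  unfold dsNext at h
  split at h
  · cases h
  · rename_i x hx
    obtain ⟨h1, h2, _⟩ := shortStart_some h
    rw [msetMax_some] at hx
    obtain ⟨E, hE, rfl⟩ := Multiset.mem_map.1 hx.1
    have := (Multiset.mem_filter.1 hE).2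
    exact ⟨h1, by rw [h2]; exact this.1⟩

theorem usNext_phi {a b r : ℤ} {n : Multiset Seg} (hn : Rg a b r n) {p : Seg} (hp : p ∈ n) :
    usNext (n.map (phi r)) (phi r p) = (dsNext n p).map (phi r) := by
  have hf : (n.map (phi r)).filter (fun Δ => Prec (phi r p) Δ)
      = (n.filter fun Δ => Prec Δ p).map (phi r) := by
    rw [Multiset.filter_map]
    congr 1
    exact Multiset.filter_congr fun Δ hΔ => prec_phi hn hp hΔ
  unfold usNext dsNext
  rw [hf, map_phi_fst, msetMin_sub]
  cases hM : msetMax ((n.filter fun Δ => Prec Δ p).map Prod.fst) with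
  | none => rfl
  | some x =>
    simp only [Option.map_some]
    rw [← longStart_phi]
    have : Multiset.filter (fun Δ => Δ.1 = 1 - x) ((n.filter fun Δ => Prec Δ p).map (phi r))
        = (startAt (n.filter fun Δ => Prec Δ p) x).map (phi r) := startAt_phi r _ x
    rw [this]
    unfold longStart
    rw [startAt_phi, map_phi_snd, map_phi_snd, msetMax_sub, msetMax_sub]
    congr 2
    rw [msetMax_some] at hM
    obtain ⟨E, hE, rfl⟩ := Multiset.mem_map.1 hM.1
    obtain ⟨hEn, hEp⟩ := Multiset.mem_filter.1 hE
    obtain ⟨D, hD⟩ := shortStart_isSome hEn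
    have hD' := hD
    unfold shortStart at hD'
    obtain ⟨y, hy, rfl⟩ := Option.map_eq_some_iff.1 hD'
    rw [hy, msetMin_some]
    obtain ⟨h1, h2, h3⟩ := shortStart_some hD
    refine ⟨Multiset.mem_map.2 ⟨_, Multiset.mem_filter.2 ⟨Multiset.mem_filter.2 ⟨h1, ?_⟩, rfl⟩, rfl⟩, ?_⟩
    · have a1 := hn _ h1
      have a2 := hn _ hp
      have a3 := h3 _ hEn rfl
      simp only [Prec] at hEp a1 a3 ⊢
      omega
    · intro z hz
      obtain ⟨F, hF, rfl⟩ := Multiset.mem_map.1 hz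
      obtain ⟨hF1, hF2⟩ := Multiset.mem_filter.1 hF
      exact h3 F (Multiset.mem_filter.1 hF1).1 hF2

theorem usAux_phi {a b r : ℤ} {n : Multiset Seg} (hn : Rg a b r n) (k : ℕ) :
    ∀ p ∈ n, usAux (n.map (phi r)) k (phi r p) = (dsAux n k p).map (phi r) := by
  induction k with
  | zero => intro p _; rfl
  | succ k ih =>
    intro p hp
    simp only [usAux, dsAux]
    rw [usNext_phi hn hp]
    cases h : dsNext n p with
    | none => rfl
    | some Δ =>
      simp only [Option.map_some, List.map_cons]
      rw [ih Δ (dsNext_some h).1]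

theorem usList_phi {a b r : ℤ} {n : Multiset Seg} (hn : Rg a b r n) :
    usList (n.map (phi r)) = (dsList n).map (phi r) := by
  unfold usList dsList
  rw [map_phi_fst, msetMin_sub]
  cases h : msetMax (n.map Prod.fst) with
  | none => rfl
  | some x =>
    simp only [Option.map_some]
    rw [longStart_phi]
    cases h2 : shortStart n x with
    | none => rfl
    | some D =>
      simp only [Option.map_some, List.map_cons, Multiset.card_map]
      rw [usAux_phi hn _ _ (shortStart_some h2).1]

theorem dsAux_props (n : Multiset Seg) (k : ℕ) :
    ∀ p : Seg, (∀ Δ ∈ dsAux n k p, Δ ∈ n ∧ Δ.1 < p.1) ∧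
      (dsAux n k p).Pairwise (fun x y => y.1 < x.1) := by
  induction k with
  | zero => intro p; simp [dsAux]
  | succ k ih =>
    intro p
    simp only [dsAux]
    cases h : dsNext n p with
    | none => simp
    | some E =>
      have hE := dsNext_some h
      obtain ⟨h1, h2⟩ := ih E
      simp only [List.mem_cons, List.pairwise_cons]
      refine ⟨?_, fun Δ hΔ => (h1 Δ hΔ).2, h2⟩
      rintro Δ (rfl | hΔ)
      · exact hE
      · exact ⟨(h1 Δ hΔ).1, (h1 Δ hΔ).2.trans hE.2⟩

theorem dsList_props {n : Multiset Seg} (h0 : n ≠ 0) :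
    ∃ D l, dsList n = D :: l ∧ (∀ E ∈ n, E.1 ≤ D.1) ∧ (∀ Δ ∈ dsList n, Δ ∈ n) ∧
      (dsList n).Pairwise (fun x y => y.1 < x.1) := by
  unfold dsList
  cases h : msetMax (n.map Prod.fst) with
  | none => rw [msetMax_none, Multiset.map_eq_zero] at h; exact absurd h h0
  | some x =>
    rw [msetMax_some] at h
    obtain ⟨E, hE, rfl⟩ := Multiset.mem_map.1 h.1
    obtain ⟨D, hD⟩ := shortStart_isSome hE
    simp only [hD]
    obtain ⟨h1, h2, h3⟩ := shortStart_some hD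
    obtain ⟨g1, g2⟩ := dsAux_props n n.card D
    refine ⟨D, _, rfl, ?_, ?_, ?_⟩
    · intro F hF
      rw [h2]
      exact h.2 _ (Multiset.mem_map_of_mem _ hF)
    · intro Δ hΔ
      rcases List.mem_cons.1 hΔ with rfl | hΔ
      · exact h1
      · exact (g1 Δ hΔ).1
    · exact List.pairwise_cons.2 ⟨fun Δ hΔ => (g1 Δ hΔ).2, g2⟩

theorem dsList_le (n : Multiset Seg) : (dsList n : Multiset Seg) ≤ n := by
  by_cases h0 : n = 0
  · subst h0; simp [dsList, msetMax]
  · obtain ⟨D, l, _, _, h3, h4⟩ := dsList_props h0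
    have hnd : (dsList n).Nodup := h4.imp fun {x y} h e => by subst e; exact lt_irrefl _ h
    exact (Multiset.le_iff_subset (Multiset.coe_nodup.2 hnd)).2 fun x hx =>
      h3 x (Multiset.mem_coe.1 hx)

theorem Rg.mono {a b r : ℤ} {n n' : Multiset Seg} (hn : Rg a b r n) (h : n' ≤ n) :
    Rg a b r n' := fun Δ hΔ => hn Δ (Multiset.mem_of_le h hΔ)

theorem usDecomp_phi {a b r : ℤ} (k : ℕ) : ∀ {n : Multiset Seg}, Rg a b r n →
    usDecomp k (n.map (phi r)) = (dsDecomp k n).map (List.map (phi r)) := by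
  induction k with
  | zero => intro n _; rfl
  | succ k ih =>
    intro n hn
    simp only [usDecomp, dsDecomp, Multiset.map_eq_zero]
    by_cases h0 : n = 0
    · simp [h0]
    · rw [if_neg h0, if_neg h0, List.map_cons, usList_phi hn,
        ← ih (hn.mono (Multiset.sub_le_self n _))]
      congr 2
      have h1 : n - (dsList n : Multiset Seg) + (dsList n : Multiset Seg) = n :=
        tsub_add_cancel_of_le (dsList_le n)
      have h2 := congrArg (Multiset.map (phi r)) h1
      rw [Multiset.map_add, Multiset.map_coe] at h2
      rw [← h2, add_tsub_cancel_right]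

/-- Sum of the rows. -/
def rowSum : List (List Seg) → Multiset Seg
  | [] => 0
  | l :: ls => (l : Multiset Seg) + rowSum ls

/-- The structural facts about the rows of a downward decomposition. -/
def GoodRows (a b r : ℤ) : List (List Seg) → Prop
  | [] => True
  | l :: ls => GoodRows a b r ls ∧ Rg a b r (l : Multiset Seg) ∧
      l.Pairwise (fun x y => y.1 < x.1) ∧
      ∃ D l', l = D :: l' ∧ ∀ E ∈ rowSum ls, E.1 ≤ D.1

theorem dsDecomp_good {a b r : ℤ} (k : ℕ) : ∀ {n : Multiset Seg}, Rg a b r n → n.card ≤ k →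
    rowSum (dsDecomp k n) = n ∧ GoodRows a b r (dsDecomp k n) := by
  induction k with
  | zero =>
    intro n _ hc
    have : n = 0 := Multiset.card_eq_zero.1 (Nat.le_zero.1 hc)
    subst this
    exact ⟨rfl, trivial⟩
  | succ k ih =>
    intro n hn hc
    simp only [dsDecomp]
    by_cases h0 : n = 0
    · simp [h0, rowSum, GoodRows]
    · rw [if_neg h0]
      obtain ⟨D, l, h1, h2, h3, h4⟩ := dsList_props h0
      have hle := dsList_le n
      have hcard : (n - (dsList n : Multiset Seg)).card ≤ k := by
        rw [Multiset.card_sub hle, Multiset.coe_card, h1, List.length_cons]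
        omega
      obtain ⟨i1, i2⟩ := ih (hn.mono (Multiset.sub_le_self n (dsList n : Multiset Seg))) hcard
      refine ⟨?_, i2, hn.mono hle, h4, D, l, h1, ?_⟩
      · rw [rowSum, i1]; exact add_tsub_cancel_of_le hle
      · intro E hE
        rw [i1] at hE
        exact h2 E (Multiset.mem_of_le (Multiset.sub_le_self n _) hE)

/-- One step of the integral selection on a state. -/
def stepI (a : ℤ) (row : List Seg) (s : ℤ × Multiset Seg) : ℤ × Multiset Seg :=
  match findRowI a row s.1 with
  | some Δ => (Δ.1, pushSeg (s.2.erase Δ) s.1 Δ.2)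
  | none => s

/-- One step of the derivative selection on a state. -/
def stepD (row : List Seg) (s : ℤ × Multiset Seg) : ℤ × Multiset Seg :=
  match findRowD row s.1 with
  | some Δ => (Δ.1 - 1, pushSeg (s.2.erase Δ) (s.1 + 1) Δ.2)
  | none => s

theorem selAuxI_append (a : ℤ) (rows ex : List (List Seg)) (n : ℕ) (hn : n ≤ rows.length) :
    ∀ pt, selAuxI a (rows ++ ex) n pt = selAuxI a rows n pt := by
  induction n with
  | zero => intro pt; rfl
  | succ n ih =>
    intro pt
    simp only [selAuxI]
    rw [List.getD_append _ _ _ _ (by omega)]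
    simp only [ih (by omega)]

theorem selAuxD_append (rows ex : List (List Seg)) (n : ℕ) (hn : n ≤ rows.length) :
    ∀ pt, selAuxD (rows ++ ex) n pt = selAuxD rows n pt := by
  induction n with
  | zero => intro pt; rfl
  | succ n ih =>
    intro pt
    simp only [selAuxD]
    rw [List.getD_append _ _ _ _ (by omega)]
    simp only [ih (by omega)]

theorem selI_fold (a : ℤ) (rows : List (List Seg)) : ∀ (pt : ℤ) (acc : Multiset Seg),
    rows.foldr (stepI a) (pt, acc) =
      ((((selAuxI a rows rows.length pt).getLast?).map fun q => q.1.1).getD pt,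
       (selAuxI a rows rows.length pt).foldl (fun acc p => pushSeg (acc.erase p.1) p.2 p.1.2) acc)
      := by
  induction rows using List.reverseRecOn with
  | nil => intro pt acc; rfl
  | append_singleton pref last ih =>
    intro pt acc
    have hg : (pref ++ [last]).getD pref.length [] = last := by simp
    rw [List.foldr_append, List.length_append]
    simp only [List.length_singleton, selAuxI, hg, List.foldr_cons, List.foldr_nil, stepI]
    cases h : findRowI a last pt with
    | none =>
      simp only
      rw [selAuxI_append _ _ _ _ le_rfl, ih]
    | some Δ =>
      simp only
      rw [selAuxI_append _ _ _ _ le_rfl, ih]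
      simp only [List.foldl_cons, List.getLast?_cons, Option.map_some, Option.getD_some]
      cases (selAuxI a pref pref.length Δ.1).getLast? <;> rfl

theorem selD_fold (rows : List (List Seg)) : ∀ (pt : ℤ) (acc : Multiset Seg),
    rows.foldr stepD (pt, acc) =
      ((((selAuxD rows rows.length pt).getLast?).map fun q => q.1.1 - 1).getD pt,
       (selAuxD rows rows.length pt).foldl (fun acc p => pushSeg (acc.erase p.1) p.2 p.1.2) acc)
      := by
  induction rows using List.reverseRecOn with
  | nil => intro pt acc; rfl
  | append_singleton pref last ih =>
    intro pt acc
    have hg : (pref ++ [last]).getD pref.length [] = last := by simp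
    rw [List.foldr_append, List.length_append]
    simp only [List.length_singleton, selAuxD, hg, List.foldr_cons, List.foldr_nil, stepD]
    cases h : findRowD last pt with
    | none =>
      simp only
      rw [selAuxD_append _ _ _ le_rfl, ih]
    | some Δ =>
      simp only
      rw [selAuxD_append _ _ _ le_rfl, ih]
      simp only [List.foldl_cons, List.getLast?_cons, Option.map_some, Option.getD_some]
      cases (selAuxD pref pref.length (Δ.1 - 1)).getLast? <;> rfl

theorem ILang_eq {a b : ℤ} {m : Multiset Seg} (h : mRange m a b = m) :
    ILang a b m = pushSeg ((dsDecomp m.card m).foldr (stepI a) (a, m)).2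
      ((dsDecomp m.card m).foldr (stepI a) (a, m)).1 b := by
  rw [selI_fold]
  simp only [ILang, h]
  cases (selAuxI a (dsDecomp m.card m) (dsDecomp m.card m).length a).getLast? <;> rfl

theorem DLang_eq {a b : ℤ} (hab : a ≤ b) {m : Multiset Seg} (h : mRange m a b = m) :
    DLang a b m = if ((usDecomp m.card m).foldr stepD (b, m)).1 = a - 1 then
      some ((usDecomp m.card m).foldr stepD (b, m)).2 else none := by
  rw [selD_fold]
  simp only [DLang, h]
  cases (selAuxD (usDecomp m.card m) (usDecomp m.card m).length b).getLast? with
  | none =>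
    have : b ≠ a - 1 := by omega
    simp [this]
  | some q => simp

theorem findRow_cases {a b r pt : ℤ} (hpt : a ≤ pt) : ∀ (D : Seg) (l : List Seg),
    pt ≤ D.1 → Rg a b r ((D :: l : List Seg) : Multiset Seg) →
    (D :: l).Pairwise (fun x y => y.1 < x.1) →
    (∃ E ∈ D :: l, pt < E.1 ∧ findRowI a (D :: l) pt = some E ∧
      findRowD ((D :: l).map (phi r)) (-pt) = some (phi r E)) ∨
    (∃ E ∈ D :: l, E.1 = pt ∧ findRowI a (D :: l) pt = none ∧
      findRowD ((D :: l).map (phi r)) (-pt) = some (phi r E)) := by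
  have hnone : ∀ l : List Seg, (∀ E ∈ l, E.1 ≤ pt) → findRowI a l pt = none := by
    intro l
    induction l with
    | nil => intro _; rfl
    | cons x l ih =>
      intro h
      have hx := h x (by simp)
      cases l with
      | nil => simp [findRowI]; omega
      | cons y l =>
        have := ih fun E hE => h E (by simp [hE])
        simp only [findRowI, this]
        simp; omega
  intro D l
  induction l generalizing D with
  | nil =>
    intro h1 h2 h3
    have hD := h2 D (by simp)
    rcases eq_or_lt_of_le h1 with h | h
    · right
      refine ⟨D, by simp, h.symm, hnone _ (by simp; omega), ?_⟩
      simp [findRowD, intSubB, phi]; omega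
    · left
      refine ⟨D, by simp, h, ?_, ?_⟩
      · simp [findRowI]; omega
      · simp [findRowD, intSubB, phi]; omega
  | cons y l ih =>
    intro h1 h2 h3
    have hD := h2 D (by simp)
    have h3' := List.pairwise_cons.1 h3
    rcases eq_or_lt_of_le h1 with h | h
    · right
      refine ⟨D, by simp, h.symm, hnone _ ?_, ?_⟩
      · intro E hE
        rcases List.mem_cons.1 hE with rfl | hE
        · exact h.ge
        · exact (h3'.1 E hE).le.trans h.ge
      · simp [findRowD, intSubB, phi]; omega
    · by_cases hy : y.1 + 1 ≤ pt
      · left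
        refine ⟨D, by simp, h, ?_, ?_⟩
        · simp [findRowI]; omega
        · simp [findRowD, intSubB, phi]; omega
      · have e1 : findRowI a (D :: y :: l) pt = findRowI a (y :: l) pt := by
          simp [findRowI]; omega
        have e2 : findRowD ((D :: y :: l).map (phi r)) (-pt)
            = findRowD ((y :: l).map (phi r)) (-pt) := by
          have : intSubB (phi r D).1 (-pt) (phi r D).1 ((phi r y).1 - 2) = false := by
            simp [intSubB, phi]; omega
          simp only [List.map_cons, findRowD, this]
          simp
        rw [e1, e2]
        rcases ih y (by omega) (fun E hE => h2 E (by simp at hE ⊢; tauto)) h3'.2 with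
          ⟨E, hE, hh⟩ | ⟨E, hE, hh⟩
        · exact Or.inl ⟨E, List.mem_cons_of_mem _ hE, hh⟩
        · exact Or.inr ⟨E, List.mem_cons_of_mem _ hE, hh⟩

theorem main_fold {a b r : ℤ} (hab : a ≤ b) : ∀ (rows : List (List Seg)), GoodRows a b r rows →
    ∃ (p : ℤ) (B : Multiset Seg), a ≤ p ∧ p ≤ b + 1 ∧ B.card = (rowSum rows).card ∧
      (∀ M, a ≤ M → (∀ E ∈ rowSum rows, E.1 ≤ M) → p ≤ M) ∧
      ∀ X : Multiset Seg, rows.foldr (stepI a) (a, X + rowSum rows) = (p, X + B) ∧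
        (rows.map (List.map (phi r))).foldr stepD (-a, (X + rowSum rows).map (phi r))
          = (-p, (X + B).map (phi r)) := by
  intro rows
  induction rows with
  | nil =>
    intro _
    exact ⟨a, 0, le_rfl, by omega, rfl, fun M h _ => h, fun X => ⟨rfl, rfl⟩⟩
  | cons l ls ih =>
    rintro ⟨g1, g2, g3, D, l', rfl, g4⟩
    obtain ⟨p, B, hp1, hp2, hB, hM, hX⟩ := ih g1
    have hD := g2 D (by simp)
    have hpD : p ≤ D.1 := hM _ hD.1 g4
    have hassoc : ∀ X : Multiset Seg, X + rowSum ((D :: l') :: ls)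
        = (X + ((D :: l' : List Seg) : Multiset Seg)) + rowSum ls := by
      intro X; rw [rowSum, add_assoc]
    rcases findRow_cases hp1 D l' hpD g2 g3 with ⟨E, hE, hpE, hI, hDd⟩ | ⟨E, hE, hpE, hI, hDd⟩
    · have hEr := g2 E (Multiset.mem_coe.2 hE)
      refine ⟨E.1, ((D :: l' : List Seg) : Multiset Seg).erase E + B + {(p, E.2)}, hEr.1, hEr.2.1,
        ?_, ?_, ?_⟩
      · rw [rowSum, Multiset.card_add, Multiset.card_add, Multiset.card_add,
          Multiset.card_erase_of_mem (Multiset.mem_coe.2 hE), hB]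
        simp
        omega
      · intro M _ h
        exact h E (Multiset.mem_add.2 (Or.inl (Multiset.mem_coe.2 hE)))
      · intro X
        have herase : (X + ((D :: l' : List Seg) : Multiset Seg) + B).erase E
            = X + ((D :: l' : List Seg) : Multiset Seg).erase E + B := by
          rw [Multiset.erase_add_left_pos, Multiset.erase_add_right_pos]
          · exact Multiset.mem_coe.2 hE
          · exact Multiset.mem_add.2 (Or.inr (Multiset.mem_coe.2 hE))
        obtain ⟨x1, x2⟩ := hX (X + ((D :: l' : List Seg) : Multiset Seg))
        rw [hassoc, List.map_cons, List.foldr_cons, List.foldr_cons, x1, x2]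
        constructor
        · simp only [stepI, hI]
          rw [herase, pushSeg, if_pos (by omega)]
          simp only [add_assoc]
        · simp only [stepD, hDd]
          rw [← Multiset.map_erase _ (phi_inj r), herase, pushSeg,
            if_pos (by simp only [phi]; omega)]
          refine Prod.ext (by simp only [phi]; omega) ?_
          simp only [Multiset.map_add, Multiset.map_singleton, add_assoc, phi]
          congr 5
          omega
    · refine ⟨p, ((D :: l' : List Seg) : Multiset Seg) + B, hp1, hp2, ?_, ?_, ?_⟩
      · rw [rowSum, Multiset.card_add, Multiset.card_add, hB]
      · intro M _ h
        rw [← hpE]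
        exact h E (Multiset.mem_add.2 (Or.inl (Multiset.mem_coe.2 hE)))
      · intro X
        obtain ⟨x1, x2⟩ := hX (X + ((D :: l' : List Seg) : Multiset Seg))
        have hEr := g2 E (Multiset.mem_coe.2 hE)
        rw [hassoc, List.map_cons, List.foldr_cons, List.foldr_cons, x1, x2]
        constructor
        · simp only [stepI, hI, add_assoc]
        · simp only [stepD, hDd]
          rw [pushSeg, if_pos (by simp only [phi]; omega)]
          have e : ((-p + 1, (phi r E).2) : Seg) = phi r E := by
            refine Prod.ext ?_ rfl
            simp only [phi]; omega
          rw [e, add_comm, Multiset.singleton_add, Multiset.cons_erase]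
          · refine Prod.ext (by simp only [phi]; omega) ?_
            simp only [add_assoc]
          · apply Multiset.mem_map_of_mem
            simp only [Multiset.mem_add, Multiset.mem_coe]
            exact Or.inl (Or.inr hE)

theorem mRange_phi {a b r : ℤ} {n : Multiset Seg} (hn : Rg a b r n) :
    mRange (n.map (phi r)) (-b) (-a) = n.map (phi r) := by
  unfold mRange
  rw [Multiset.filter_eq_self]
  intro Δ hΔ
  obtain ⟨E, hE, rfl⟩ := Multiset.mem_map.1 hΔ
  have := hn E hE
  simp only [phi]
  omega

theorem DLangL_eq {a b r : ℤ} (hab : a ≤ b) {n : Multiset Seg} (hn : Rg a b r n) {p : ℤ}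
    {B : Multiset Seg}
    (h : ((dsDecomp n.card n).map (List.map (phi r))).foldr stepD (-a, n.map (phi r))
      = (-p, B.map (phi r))) :
    DLangL a b (Dual r n) = if p = b + 1 then some (Dual r B) else none := by
  unfold DLangL
  rw [theta_dual, DLang_eq (by omega) (mRange_phi hn), Multiset.card_map, usDecomp_phi _ hn, h]
  by_cases hp : p = b + 1
  · rw [if_pos (by simp only; omega), if_pos hp, Option.map_some, theta_phi]
  · rw [if_neg (by simp only; omega), if_neg hp]; rfl

theorem dsDecomp_add {a b r : ℤ} {m : Multiset Seg} (hm : Rg a b r m) :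
    dsDecomp (m + {(b + 1, b)}).card (m + {(b + 1, b)}) = [(b + 1, b)] :: dsDecomp m.card m := by
  have hl : dsList (m + {(b + 1, b)}) = [(b + 1, b)] := by
    have hmem : ((b + 1, b) : Seg) ∈ m + {(b + 1, b)} := by simp
    have h1 : msetMax ((m + {(b + 1, b)}).map Prod.fst) = some (b + 1) := by
      rw [msetMax_some]
      refine ⟨Multiset.mem_map.2 ⟨_, hmem, rfl⟩, ?_⟩
      intro y hy
      obtain ⟨E, hE, rfl⟩ := Multiset.mem_map.1 hy
      rcases Multiset.mem_add.1 hE with hE | hE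
      · exact (hm E hE).2.1
      · rw [Multiset.mem_singleton.1 hE]
    have h2 : shortStart (m + {(b + 1, b)}) (b + 1) = some (b + 1, b) := by
      obtain ⟨E, hE⟩ := shortStart_isSome hmem
      simp only at hE
      obtain ⟨e1, e2, e3⟩ := shortStart_some hE
      have e4 := e3 _ hmem rfl
      rw [hE]
      congr 1
      refine Prod.ext e2 ?_
      rcases Multiset.mem_add.1 e1 with hE | hE
      · have := (hm E hE).2.2.1
        simp only at e4 ⊢
        omega
      · rw [Multiset.mem_singleton.1 hE]
    have h3 : dsNext (m + {(b + 1, b)}) (b + 1, b) = none := by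
      unfold dsNext
      have : (m + {(b + 1, b)}).filter (fun Δ => Prec Δ (b + 1, b)) = 0 := by
        rw [Multiset.filter_eq_nil]
        intro E hE hP
        rcases Multiset.mem_add.1 hE with hE | hE
        · have := (hm E hE).2.2.1
          simp only [Prec] at hP
          omega
        · rw [Multiset.mem_singleton.1 hE] at hP
          simp only [Prec] at hP
          omega
      rw [this]
      simp [msetMax]
    unfold dsList
    rw [h1]
    simp only [h2]
    rw [Multiset.card_add, Multiset.card_singleton]
    simp only [dsAux, h3]
  rw [Multiset.card_add, Multiset.card_singleton]
  simp only [dsDecomp]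
  rw [if_neg (by simp), hl]
  congr 2
  simp

/-- exotic duality between the right integral algorithm and the
left derivative algorithm, for `m` in good range for `[a,b]` and all
sufficiently large `r > 0`. -/
theorem stmt7 (m : Multiset Seg) (hm : IsMS m) (a b : ℤ) (hab : a ≤ b)
    (hgr : GoodRange m a b) :
    ∃ R : ℤ, 0 < R ∧ ∀ r : ℤ, R ≤ r →
      ((ILang a b m).card = m.card →
          DLangL a b (Dual r m) = some (Dual r (ILang a b m))) ∧
      (m.card < (ILang a b m).card →
          DLangL a b (DualAB r a b m) = some (Dual r (ILang a b m))) ∧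
      ((ILang a b m).card = m.card ↔ DLangL a b (Dual r m) ≠ none) := by
  obtain ⟨K, hK⟩ : ∃ K : ℤ, ∀ Δ ∈ m, Δ.2 ≤ K := by
    clear hm hgr
    induction m using Multiset.induction_on with
    | empty => exact ⟨0, by simp⟩
    | cons x m ih =>
      obtain ⟨K, hK⟩ := ih
      refine ⟨max x.2 K, ?_⟩
      intro Δ hΔ
      rcases Multiset.mem_cons.1 hΔ with rfl | hΔ
      · exact le_max_left _ _
      · exact (hK Δ hΔ).trans (le_max_right _ _)
  refine ⟨max K b + 2 - a, by have := le_max_right K b; omega, ?_⟩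
  intro r hr
  have hr1 := le_max_left K b
  have hr2 := le_max_right K b
  have hRg : Rg a b r m := by
    intro Δ hΔ
    have h1 := hK Δ hΔ
    rw [GoodRange, mRange, Multiset.filter_eq_self] at hgr
    have h2 := hgr Δ hΔ
    omega
  obtain ⟨s1, s2⟩ := dsDecomp_good m.card hRg le_rfl
  obtain ⟨p, B, hp1, hp2, hB, -, hX⟩ := main_fold hab _ s2
  rw [s1] at hX hB
  obtain ⟨x1, x2⟩ := hX 0
  rw [zero_add, zero_add] at x1 x2
  have hI : ILang a b m = pushSeg B p b := by rw [ILang_eq hgr, x1]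
  have hD := DLangL_eq hab hRg x2
  have hcard : (ILang a b m).card = m.card ↔ p = b + 1 := by
    rw [hI, pushSeg]
    split
    · rw [Multiset.card_add, hB]; simp; omega
    · rw [hB]; simp; omega
  refine ⟨?_, ?_, ?_⟩
  · intro h
    have hp := hcard.1 h
    rw [hD, if_pos hp, hI, pushSeg, if_neg (by omega)]
  · intro h
    have hp : p ≤ b := by
      have : ¬ p = b + 1 := fun e => by have := hcard.2 e; omega
      omega
    have hRg' : Rg a b r (m + {(b + 1, b)}) := by
      intro Δ hΔ
      rcases Multiset.mem_add.1 hΔ with hΔ | hΔ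
      · exact hRg Δ hΔ
      · rw [Multiset.mem_singleton.1 hΔ]; simp only; omega
    have hdual : DualAB r a b m = Dual r (m + {(b + 1, b)}) := by
      simp only [DualAB, Dual, Multiset.map_add, Multiset.map_singleton]
      congr 3 <;> omega
    have hfold : ((dsDecomp (m + {(b + 1, b)}).card (m + {(b + 1, b)})).map
        (List.map (phi r))).foldr stepD (-a, (m + {(b + 1, b)}).map (phi r))
        = (-(b + 1), (B + {(p, b)}).map (phi r)) := by
      rw [dsDecomp_add hRg, List.map_cons, List.foldr_cons, add_comm m, (hX _).2]
      have hf : findRowD (List.map (phi r) [(b + 1, b)]) (-p) = some (phi r (b + 1, b)) := by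
        simp [findRowD, intSubB, phi]; omega
      simp only [stepD, hf]
      rw [← Multiset.map_erase _ (phi_inj r), pushSeg, if_pos (by simp only [phi]; omega)]
      refine Prod.ext (by simp only [phi]; omega) ?_
      have he : (({(b + 1, b)} + B : Multiset Seg)).erase (b + 1, b) = B := by simp
      rw [he]
      simp only [Multiset.map_add, Multiset.map_singleton, phi]
      congr 3
      omega
    rw [hdual, DLangL_eq hab hRg' hfold, if_pos rfl, hI, pushSeg, if_pos hp]
  · rw [hcard, hD]
    by_cases hp : p = b + 1 <;> simp [hp]

end Multiseg
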